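/- Let l be a field of characteristic p > 0, let I be a finite set of non-negative integers, and for each i in I let u_i be an element of l not lying in l^p. If the differential form sum over i in I of u_i^{p^i - 1} d u_i equals 0 in Omega^1_l, then (by repeated application of the Cartier operator) each u_i lies in l^p, a contradiction; hence the sum is nonzero. Formally: if for each i in I, u_i is not in l^p, then sum_{i in I} u_i^{p^i - 1} du_i is nonzero in Omega^1_l. -/

import Mathlib

open IntermediateField Polynomial in
/-- An element `u` of `l` outside `l ^ p` generates `l` over some subfield `K ⊇ l ^ p` with
`u ∉ K`. -/
theorem exists_subfield_adjoin_eq_top (p : ℕ) [Fact p.Prime] {l : Type*} [Field l] [CharP l p]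
    {u : l} (hu : ¬ ∃ c : l, c ^ p = u) :
    ∃ K : Subfield l, (∀ x, x ^ p ∈ K) ∧ u ∉ K ∧ Algebra.adjoin K {u} = ⊤ := by
  have hp : p.Prime := Fact.out
  obtain ⟨K, -, hK⟩ := zorn_le_nonempty₀ {K : Subfield l | (∀ x, x ^ p ∈ K) ∧ u ∉ K}
    (fun c hc hch y hy ↦ by
      have : Nonempty c := ⟨⟨y, hy⟩⟩
      have hd : Directed (· ≤ ·) ((↑) : c → Subfield l) := hch.directedOn.directed_val
      have hmem (z : l) : z ∈ sSup c ↔ ∃ i : c, z ∈ (i : Subfield l) := by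
        rw [sSup_eq_iSup']
        exact Subfield.mem_iSup_of_directed hd
      refine ⟨sSup c, ⟨fun x ↦ (hmem _).2 ⟨⟨y, hy⟩, (hc hy).1 x⟩, fun h ↦ ?_⟩,
        fun z hz ↦ le_sSup hz⟩
      obtain ⟨⟨i, hi⟩, h⟩ := (hmem _).1 h
      exact (hc hi).2 h)
    (frobenius l p).fieldRange
    ⟨fun x ↦ ⟨x, rfl⟩, fun ⟨c, h⟩ ↦ hu ⟨c, h⟩⟩
  obtain ⟨⟨hpow, huK⟩, hmax⟩ := hK
  have hdeg (w : l) (hw : w ∉ K) : IsIntegral K w ∧ Module.finrank K K⟮w⟯ = p := by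
    have hirr : Irreducible (X ^ p - C (⟨w ^ p, hpow w⟩ : K)) := by
      refine X_pow_sub_C_irreducible_of_prime hp fun b hb ↦ hw ?_
      have : (b : l) ^ p = w ^ p := congrArg Subtype.val hb
      rw [← frobenius_inj l p this]
      exact b.2
    have hroot : aeval w (X ^ p - C (⟨w ^ p, hpow w⟩ : K)) = 0 := by
      rw [map_sub, map_pow, aeval_X, aeval_C]
      exact sub_self _
    have hmonic : (X ^ p - C (⟨w ^ p, hpow w⟩ : K)).Monic := monic_X_pow_sub_C _ hp.ne_zero
    have hint : IsIntegral K w := ⟨_, hmonic, hroot⟩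
    refine ⟨hint, ?_⟩
    rw [adjoin.finrank hint, ← minpoly.eq_of_irreducible_of_monic hirr hroot hmonic,
      natDegree_X_pow_sub_C]
  refine ⟨K, hpow, huK, ?_⟩
  rw [← adjoin_simple_toSubalgebra_of_isAlgebraic (hdeg u huK).1.isAlgebraic,
    ← top_toSubalgebra, toSubalgebra_inj, eq_top_iff]
  rintro v -
  by_cases hv : v ∈ K
  · exact (K⟮u⟯).algebraMap_mem ⟨v, hv⟩
  have huv : u ∈ K⟮v⟯ := by
    by_contra h
    refine hv (hmax (y := K⟮v⟯.toSubfield) ⟨fun x ↦ K⟮v⟯.algebraMap_mem ⟨_, hpow x⟩, h⟩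
      (fun x hx ↦ K⟮v⟯.algebraMap_mem ⟨x, hx⟩) (mem_adjoin_simple_self K v))
  have : FiniteDimensional K K⟮v⟯ := adjoin.finiteDimensional (hdeg v hv).1
  rw [eq_of_le_of_finrank_eq (adjoin_simple_le_iff.2 huv)
    ((hdeg u huK).2.trans (hdeg v hv).2.symm)]
  exact mem_adjoin_simple_self K v

theorem exists_derivation_apply_eq_one (p : ℕ) [Fact p.Prime] {l : Type*} [Field l] [CharP l p]
    (K : Subfield l) (hpow : ∀ x : l, x ^ p ∈ K) {u : l} (hu : u ∉ K)
    (hadj : Algebra.adjoin K {u} = ⊤) :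
    ∃ D : Derivation K l l, D u = 1 := by
  have hint : IsIntegral K u :=
    .of_pow (Fact.out : p.Prime).pos (isIntegral_algebraMap (x := (⟨u ^ p, hpow u⟩ : K)))
  have : Module.Finite K l := by
    rw [Module.finite_def, ← Algebra.top_toSubmodule, ← hadj]
    exact hint.fg_adjoin_singleton
  by_cases hDu : KaehlerDifferential.D K l u = 0
  · exfalso
    have hD : KaehlerDifferential.D K l = 0 :=
      Derivation.ext_of_adjoin_eq_top {u} hadj (by simpa using hDu)
    have hsub : Subsingleton (Ω[l⁄K]) := by
      rw [← Submodule.subsingleton_iff l, ← subsingleton_iff_bot_eq_top,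
        ← KaehlerDifferential.span_range_derivation, hD, eq_comm, Submodule.span_eq_bot]
      rintro _ ⟨x, rfl⟩
      rfl
    have : Algebra.FormallyUnramified K l := ⟨hsub⟩
    have : Algebra.IsSeparable K l := Algebra.FormallyUnramified.isSeparable K l
    have : IsPurelyInseparable K l := (isPurelyInseparable_iff_pow_mem K p).2 fun x ↦
      ⟨1, ⟨x ^ p, hpow x⟩, (pow_one p).symm ▸ rfl⟩
    obtain ⟨c, rfl⟩ := IsPurelyInseparable.surjective_algebraMap_of_isSeparable K l u
    exact hu c.2
  · obtain ⟨φ, hφ⟩ := Module.Projective.exists_dual_eq_one l hDu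
    exact ⟨φ.compDer (KaehlerDifferential.D K l), hφ⟩

namespace Derivation

variable {R l : Type*} [CommRing R] [Field l] [Algebra R l] (D : Derivation R l l)

theorem iterate_pow_char_mul (p : ℕ) [CharP l p] (c x : l) (n : ℕ) :
    D^[n] (c ^ p * x) = c ^ p * D^[n] x := by
  induction n generalizing x with
  | zero => rfl
  | succ n ih => simp [leibniz, leibniz_pow, ih]

open Polynomial in
theorem iterate_aeval {u : l} (hu : D u = 1) (P : R[X]) (n : ℕ) :
    D^[n] (aeval u P) = aeval u (derivative^[n] P) := by
  induction n generalizing P with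
  | zero => rfl
  | succ n ih => simp [Derivation.map_aeval, hu, ih]

/-- A form of Cartier's formula on the element `f`, for a derivation `D`. -/
def CartierFormula (p : ℕ) (f : l) : Prop := D^[p - 1] (f ^ (p - 1) * D f) = -(D f) ^ p

variable {p : ℕ} {D} [Fact p.Prime]

theorem CartierFormula.of_apply_eq_zero {f : l} (hf : D f = 0) : D.CartierFormula p f := by
  simp [CartierFormula, hf, (Fact.out : p.Prime).ne_zero, iterate_map_zero]

variable [CharP l p]

theorem CartierFormula.mul {f g : l} (hf : D.CartierFormula p f) (hg : D.CartierFormula p g) :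
    D.CartierFormula p (f * g) := by
  have hp : p ≠ 0 := (Fact.out : p.Prime).ne_zero
  unfold CartierFormula at *
  have : (f * g) ^ (p - 1) * D (f * g) =
      f ^ p * (g ^ (p - 1) * D g) + g ^ p * (f ^ (p - 1) * D f) := by
    rw [leibniz, smul_eq_mul, smul_eq_mul, mul_pow, ← pow_sub_one_mul hp f,
      ← pow_sub_one_mul hp g]
    ring
  rw [this, iterate_map_add, D.iterate_pow_char_mul p, D.iterate_pow_char_mul p, hf, hg, leibniz,
    smul_eq_mul, smul_eq_mul, add_pow_char, mul_pow, mul_pow]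
  ring

theorem CartierFormula.inv {f : l} (hf : D.CartierFormula p f) : D.CartierFormula p f⁻¹ := by
  have hp : p ≠ 0 := (Fact.out : p.Prime).ne_zero
  rcases eq_or_ne f 0 with rfl | h0
  · simpa using hf
  unfold CartierFormula at *
  have : f⁻¹ ^ (p - 1) * D f⁻¹ = (-f⁻¹ ^ 2) ^ p * (f ^ (p - 1) * D f) := by
    have hneg : (-f⁻¹ ^ 2) ^ p = -(f⁻¹ ^ 2) ^ p := map_neg (frobenius l p) _
    rw [hneg, leibniz_inv, smul_eq_mul, ← pow_sub_one_mul hp (f⁻¹ ^ 2)]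
    have hf1 : (f⁻¹ ^ 2) ^ (p - 1) * f ^ (p - 1) = f⁻¹ ^ (p - 1) := by
      rw [← mul_pow]
      congr 1
      field_simp
    linear_combination (f⁻¹ ^ 2 * D f) * hf1
  rw [this, D.iterate_pow_char_mul p, hf, leibniz_inv, smul_eq_mul, mul_pow, mul_neg]

theorem iterate_pow_mul_apply_eq_zero (hD : ∀ x, D^[p] x = 0) (f : l) {k : ℕ} (hk : k < p - 1) :
    D^[p - 1] (f ^ k * D f) = 0 := by
  have hp : p - 1 + 1 = p := Nat.sub_add_cancel (Fact.out : p.Prime).one_le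
  have hk0 : ((k + 1 : ℕ) : l) ≠ 0 := by
    rw [Ne, CharP.cast_eq_zero_iff l p]
    exact fun h ↦ absurd (Nat.le_of_dvd k.succ_pos h) (by omega)
  have h : D (f ^ (k + 1)) = ((k + 1 : ℕ) : l) * (f ^ k * D f) := by
    simp [leibniz_pow]
  have h2 : D^[p - 1] (D (f ^ (k + 1))) = 0 := by
    rw [← Function.iterate_succ_apply, Nat.succ_eq_add_one, hp, hD]
  rw [h, ← nsmul_eq_mul, iterate_map_nsmul, nsmul_eq_mul] at h2
  exact (mul_eq_zero.1 h2).resolve_left hk0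

theorem CartierFormula.add_one (hD : ∀ x, D^[p] x = 0) {f : l} (hf : D.CartierFormula p f) :
    D.CartierFormula p (f + 1) := by
  unfold CartierFormula at *
  have h : (f + 1) ^ (p - 1) * D (f + 1) = f ^ (p - 1) * D f +
      ∑ k ∈ Finset.range (p - 1), (p - 1).choose k • (f ^ k * D f) := by
    rw [add_pow, Finset.sum_range_succ, map_add, map_one_eq_zero, add_mul, Finset.sum_mul, add_comm]
    simp [mul_left_comm, mul_assoc]
  have hsum : D^[p - 1] (∑ k ∈ Finset.range (p - 1), (p - 1).choose k • (f ^ k * D f)) = 0 := by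
    rw [← D.coeFn_coe, ← Module.End.coe_pow, map_sum]
    refine Finset.sum_eq_zero fun k hk ↦ ?_
    rw [map_nsmul, Module.End.coe_pow, D.coeFn_coe,
      iterate_pow_mul_apply_eq_zero hD f (Finset.mem_range.1 hk), smul_zero]
  rw [h, iterate_map_add, hsum, hf, map_add, map_one_eq_zero]
  simp

theorem CartierFormula.add (hD : ∀ x, D^[p] x = 0) {f g : l} (hf : D.CartierFormula p f)
    (hg : D.CartierFormula p g) : D.CartierFormula p (f + g) := by
  rcases eq_or_ne g 0 with rfl | h0
  · simpa using hf
  · have : f + g = (f * g⁻¹ + 1) * g := by field_simp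
    rw [this]
    exact ((hf.mul hg.inv).add_one hD).mul hg

end Derivation

open Polynomial in
/-- For `u` outside `l ^ p` there is a derivation `D` of `l` with `D u = 1` and `D ^ p = 0` that
satisfies Cartier's formula on all elements. -/
theorem exists_derivation_cartierFormula (p : ℕ) [Fact p.Prime] {l : Type*} [Field l] [CharP l p]
    {u : l} (hu : ¬ ∃ c : l, c ^ p = u) :
    ∃ D : Derivation ℤ l l, D u = 1 ∧ (∀ x, D^[p] x = 0) ∧ ∀ f, D.CartierFormula p f := by
  obtain ⟨K, hpow, huK, hadj⟩ := exists_subfield_adjoin_eq_top p hu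
  obtain ⟨D, hDu⟩ := exists_derivation_apply_eq_one p K hpow huK hadj
  have hp : p.Prime := Fact.out
  have hD (x : l) : D^[p] x = 0 := by
    have hx : x ∈ Algebra.adjoin K {u} := hadj ▸ Algebra.mem_top
    obtain ⟨P, rfl⟩ := Algebra.adjoin_mem_exists_aeval K u hx
    rw [D.iterate_aeval hDu, iterate_derivative_eq_factorial_smul_sum, map_nsmul, nsmul_eq_mul,
      (CharP.cast_eq_zero_iff l p _).2 (Nat.dvd_factorial hp.pos le_rfl), zero_mul]
  have hCu : D.CartierFormula p u := by
    have h := D.iterate_aeval hDu (X ^ (p - 1)) (p - 1)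
    rw [iterate_derivative_X_pow_eq_natCast_mul] at h
    have hW : (((p - 1).factorial : ℕ) : l) = -1 := by
      have := congrArg (ZMod.castHom dvd_rfl l) (ZMod.wilsons_lemma p)
      rwa [map_natCast, map_neg, map_one] at this
    simp only [Nat.descFactorial_self, Nat.sub_self, map_pow, aeval_X, pow_zero, mul_one,
      map_natCast, hW] at h
    simp [Derivation.CartierFormula, hDu, h]
  refine ⟨D.restrictScalars ℤ, hDu, hD, fun f ↦ ?_⟩
  have hf : f ∈ Algebra.adjoin K {u} := hadj ▸ Algebra.mem_top
  change D.CartierFormula p f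
  induction hf using Algebra.adjoin_induction with
  | mem x hx => rwa [Set.mem_singleton_iff.1 hx]
  | algebraMap x => exact .of_apply_eq_zero (D.map_algebraMap x)
  | add x y _ _ hx hy => exact hx.add hD hy
  | mul x y _ _ hx hy => exact hx.mul hy

theorem Derivation.sum_filter_pow_mul_eq_zero {p : ℕ} [Fact p.Prime] {l : Type*} [Field l]
    [CharP l p] {D : Derivation ℤ l l} (hD : ∀ x, D^[p] x = 0) (hC : ∀ f, D.CartierFormula p f)
    {I : Finset ℕ} {u : ℕ → l} (h : ∑ i ∈ I, u i ^ (p ^ i - 1) * D (u i) = 0) (k : ℕ) :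
    ∑ i ∈ I with k ≤ i, u i ^ (p ^ (i - k) - 1) * D (u i) = 0 := by
  have hp : p.Prime := Fact.out
  have hp1 : p - 1 + 1 = p := Nat.sub_add_cancel hp.one_le
  induction k with
  | zero => simpa using h
  | succ k ih =>
    have key (i : ℕ) :
        D^[p - 1] (if k ≤ i then u i ^ (p ^ (i - k) - 1) * D (u i) else 0) =
        -(if k + 1 ≤ i then u i ^ (p ^ (i - (k + 1)) - 1) * D (u i) else 0) ^ p := by
      rcases lt_trichotomy i k with hik | rfl | hik
      · rw [if_neg (by omega), if_neg (by omega), zero_pow hp.ne_zero, iterate_map_zero, neg_zero]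
      · simp [← Function.iterate_succ_apply, hp1, hD, hp.ne_zero]
      · rw [if_pos hik.le, if_pos (Nat.succ_le_of_lt hik)]
        obtain ⟨m, rfl⟩ := Nat.exists_eq_add_of_lt hik
        have hm : 1 ≤ p ^ m := Nat.one_le_pow _ _ hp.pos
        have e : p ^ (m + 1) - 1 = (p ^ m - 1) * p + (p - 1) := by
          have := Nat.mul_le_mul_right p hm
          rw [pow_succ, Nat.sub_mul]
          omega
        rw [show k + m + 1 - k = m + 1 by omega, show k + m + 1 - (k + 1) = m by omega, e,
          pow_add, pow_mul, mul_assoc, D.iterate_pow_char_mul p, hC, mul_pow, mul_neg]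
    rw [Finset.sum_filter] at ih ⊢
    replace ih := congrArg (D^[p - 1]) ih
    rw [iterate_map_zero, ← D.coeFn_coe, ← Module.End.coe_pow, map_sum, Module.End.coe_pow,
      D.coeFn_coe, Finset.sum_congr rfl fun i _ ↦ key i, Finset.sum_neg_distrib, neg_eq_zero,
      ← sum_pow_char] at ih
    exact eq_zero_of_pow_eq_zero ih

open KaehlerDifferential in
theorem stmt3 (p : ℕ) [Fact p.Prime] (l : Type) [Field l] [CharP l p]
    (I : Finset ℕ) (hI : I.Nonempty) (u : ℕ → l)
    -- each `u i` does not lie in `l^p`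
    (hu : ∀ i ∈ I, ¬ ∃ c : l, c ^ p = u i) :
    -- then `∑_{i ∈ I} u_i^{p^i - 1} d u_i ≠ 0` in the absolute Kähler differentials `Ω¹_l`
    (∑ i ∈ I, (u i) ^ (p ^ i - 1) • (KaehlerDifferential.D ℤ l) (u i)) ≠ 0 := by
  intro h
  have hn := I.max'_mem hI
  obtain ⟨D, hDu, hD, hC⟩ := exists_derivation_cartierFormula p (hu _ hn)
  have h' := congrArg D.liftKaehlerDifferential h
  simp only [map_sum, map_smul, Derivation.liftKaehlerDifferential_comp_D, smul_eq_mul,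
    map_zero] at h'
  have hfilter : {i ∈ I | I.max' hI ≤ i} = {I.max' hI} := by
    ext i
    simp only [Finset.mem_filter, Finset.mem_singleton]
    exact ⟨fun hi ↦ le_antisymm (I.le_max' i hi.1) hi.2, by rintro rfl; exact ⟨hn, le_rfl⟩⟩
  have hmax := Derivation.sum_filter_pow_mul_eq_zero hD hC h' (I.max' hI)
  rw [hfilter] at hmax
  simp [hDu] at hmax
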